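/- Let (X,d) be a Polish space, N ≥ 2, and let f : [0,∞) → ℝ ∪ {+∞} satisfy (F1) and (F2). Let ρ ∈ P(X) satisfy conditions (A) and (B). Then the Monge–Kantorovich infimum inf_{γ ∈ Γ(ρ)} ∫_{X^N} c(x₁,…,x_N) dγ(x₁,…,x_N) is attained, i.e. there exists a minimizer γ ∈ Γ(ρ) of the total cost C(γ) = ∫_{X^N} c dγ. -/

import Mathlib

open MeasureTheory Metric Filter Set
open scoped ENNReal NNReal Topology BigOperators

noncomputable section

/-- The positive part of an extended real number, as an element of `ℝ≥0∞`. -/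
def erealPosPart (a : EReal) : ℝ≥0∞ := if a = ⊤ then ⊤ else ENNReal.ofReal a.toReal

/-- The (signed) integral of an `EReal`-valued function: positive part minus negative part. -/
def erealIntegral {α : Type*} [MeasurableSpace α] (μ : Measure α) (g : α → EReal) : EReal :=
  ((∫⁻ x, erealPosPart (g x) ∂μ : ℝ≥0∞) : EReal) -
    ((∫⁻ x, erealPosPart (-(g x)) ∂μ : ℝ≥0∞) : EReal)

/-- The multi-marginal repulsive cost `c(x) = ∑_{1 ≤ i < j ≤ N} f(d(x_i, x_j))`. -/
def pairCost {X : Type*} [PseudoMetricSpace X] (N : ℕ) (f : ℝ → EReal) (x : Fin N → X) : EReal :=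
  ∑ p ∈ Finset.univ.filter (fun p : Fin N × Fin N => p.1 < p.2), f (dist (x p.1) (x p.2))

/-- The set of multi-marginal couplings: probability measures on `X^N` all of whose
one-dimensional marginals equal `ρ`. -/
def Coupling {X : Type*} [MeasurableSpace X] (N : ℕ) (ρ : Measure X) :
    Set (Measure (Fin N → X)) :=
  {γ | IsProbabilityMeasure γ ∧ ∀ i : Fin N, γ.map (fun x => x i) = ρ}

/-- Layer cake formula for `ℝ≥0∞`-valued functions. -/
lemma lintegral_eq_lintegral_meas_ofReal_lt {Y : Type*} [MeasurableSpace Y] (ν : Measure Y)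
    [SFinite ν] {g : Y → ℝ≥0∞} (hg : Measurable g) :
    ∫⁻ y, g y ∂ν = ∫⁻ t in Ioi (0 : ℝ), ν {y | ENNReal.ofReal t < g y} := by
  have hvol : ∀ a : ℝ≥0∞, volume.restrict (Ioi (0 : ℝ)) {t | ENNReal.ofReal t < a} = a := by
    intro a
    rw [Measure.restrict_apply (measurableSet_lt ENNReal.measurable_ofReal measurable_const)]
    induction a with
    | top => simp
    | coe a =>
      have : {t : ℝ | ENNReal.ofReal t < (a : ℝ≥0∞)} ∩ Ioi 0 = Ioo 0 (a : ℝ) := by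
        ext t
        simp only [mem_inter_iff, mem_ofPred_eq, mem_Ioi, mem_Ioo]
        constructor
        · rintro ⟨h, h0⟩
          refine ⟨h0, ?_⟩
          rw [← ENNReal.ofReal_coe_nnreal] at h
          exact (ENNReal.ofReal_lt_ofReal_iff_of_nonneg h0.le).1 h
        · rintro ⟨h0, h⟩
          refine ⟨?_, h0⟩
          rw [← ENNReal.ofReal_coe_nnreal]
          exact (ENNReal.ofReal_lt_ofReal_iff_of_nonneg h0.le).2 h
      rw [this, Real.volume_Ioo, sub_zero, ENNReal.ofReal_coe_nnreal]
  have hmeas : MeasurableSet {p : Y × ℝ | ENNReal.ofReal p.2 < g p.1} :=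
    measurableSet_lt (ENNReal.measurable_ofReal.comp measurable_snd) (hg.comp measurable_fst)
  calc ∫⁻ y, g y ∂ν
      = ∫⁻ y, volume.restrict (Ioi (0 : ℝ)) {t | ENNReal.ofReal t < g y} ∂ν := by simp_rw [hvol]
    _ = (ν.prod (volume.restrict (Ioi (0 : ℝ)))) {p | ENNReal.ofReal p.2 < g p.1} :=
      (Measure.prod_apply hmeas).symm
    _ = _ := Measure.prod_apply_symm hmeas

/-- The integral of a lower semicontinuous function is lower semicontinuous for the topology of
convergence in distribution. -/
lemma lowerSemicontinuous_lintegral_probabilityMeasure {Y : Type*} [TopologicalSpace Y]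
    [TopologicalSpace.PseudoMetrizableSpace Y] [TopologicalSpace.SeparableSpace Y]
    [MeasurableSpace Y] [BorelSpace Y] {g : Y → ℝ≥0∞} (hg : LowerSemicontinuous g) :
    LowerSemicontinuous fun ν : ProbabilityMeasure Y ↦ ∫⁻ y, g y ∂(ν : Measure Y) := by
  rw [lowerSemicontinuous_iff_le_liminf]
  intro ν
  simp_rw [lintegral_eq_lintegral_meas_ofReal_lt _ hg.measurable]
  calc ∫⁻ t in Ioi (0 : ℝ), (ν : Measure Y) {y | ENNReal.ofReal t < g y}
      ≤ ∫⁻ t in Ioi (0 : ℝ), liminf (fun ν' : ProbabilityMeasure Y ↦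
          (ν' : Measure Y) {y | ENNReal.ofReal t < g y}) (𝓝 ν) :=
        lintegral_mono fun t ↦ ProbabilityMeasure.le_liminf_measure_open_of_tendsto tendsto_id
          (hg.isOpen_preimage _)
    _ ≤ _ := lintegral_liminf_le fun ν' ↦ Antitone.measurable fun s t hst ↦
        measure_mono fun y hy ↦ (ENNReal.ofReal_le_ofReal hst).trans_lt hy

/-- The set of couplings is tight. -/
lemma isTightMeasureSet_coupling {X : Type*} [TopologicalSpace X]
    [TopologicalSpace.IsCompletelyPseudoMetrizableSpace X] [SecondCountableTopology X] [T2Space X]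
    [MeasurableSpace X] [BorelSpace X] (N : ℕ) (ρ : Measure X) [IsFiniteMeasure ρ] :
    IsTightMeasureSet (Coupling N ρ) := by
  rw [isTightMeasureSet_iff_exists_isCompact_measure_compl_le]
  intro ε hε
  have hρ : IsTightMeasureSet {ρ} := isTightMeasureSet_singleton
  rw [isTightMeasureSet_iff_exists_isCompact_measure_compl_le] at hρ
  obtain ⟨K, hK, hKε⟩ := hρ (ε / N) (ENNReal.div_pos hε.ne' (ENNReal.natCast_ne_top N))
  refine ⟨univ.pi fun _ : Fin N ↦ K, isCompact_univ_pi fun _ ↦ hK, fun γ hγ ↦ ?_⟩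
  have hsub : (univ.pi fun _ : Fin N ↦ K)ᶜ ⊆ ⋃ i : Fin N, (fun x : Fin N → X ↦ x i) ⁻¹' Kᶜ := by
    intro x hx
    simpa [Set.mem_pi] using hx
  calc γ (univ.pi fun _ : Fin N ↦ K)ᶜ
      ≤ ∑ i : Fin N, γ ((fun x : Fin N → X ↦ x i) ⁻¹' Kᶜ) :=
        (measure_mono hsub).trans (measure_iUnion_fintype_le _ _)
    _ = ∑ _i : Fin N, ρ Kᶜ := by
        refine Finset.sum_congr rfl fun i _ ↦ ?_
        rw [← hγ.2 i, Measure.map_apply (measurable_pi_apply i) hK.measurableSet.compl]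
    _ ≤ ∑ _i : Fin N, ε / N := Finset.sum_le_sum fun i _ ↦ hKε ρ rfl
    _ ≤ ε := by simpa using ENNReal.mul_div_le

/-- The set of couplings of a probability measure is compact for convergence in distribution. -/
lemma isCompact_coupling {X : Type*} [TopologicalSpace X]
    [TopologicalSpace.IsCompletelyMetrizableSpace X] [SecondCountableTopology X]
    [MeasurableSpace X] [BorelSpace X] (N : ℕ) (ρ : Measure X) [IsProbabilityMeasure ρ] :
    IsCompact {γ : ProbabilityMeasure (Fin N → X) | (γ : Measure (Fin N → X)) ∈ Coupling N ρ} := by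
  have hclosed : IsClosed
      {γ : ProbabilityMeasure (Fin N → X) | (γ : Measure (Fin N → X)) ∈ Coupling N ρ} := by
    let ρ' : ProbabilityMeasure X := ⟨ρ, inferInstance⟩
    have : {γ : ProbabilityMeasure (Fin N → X) | (γ : Measure (Fin N → X)) ∈ Coupling N ρ} =
        ⋂ i : Fin N, (fun γ : ProbabilityMeasure (Fin N → X) ↦
          γ.map (continuous_apply i).measurable.aemeasurable) ⁻¹' {ρ'} := by
      ext γ
      simp only [Coupling, mem_ofPred_eq, mem_iInter, mem_preimage, mem_singleton_iff]
      constructor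
      · exact fun h i ↦ Subtype.ext (h.2 i)
      · exact fun h ↦ ⟨inferInstance, fun i ↦ congrArg Subtype.val (h i)⟩
    rw [this]
    exact isClosed_iInter fun i ↦ isClosed_singleton.preimage
      (ProbabilityMeasure.continuous_map (continuous_apply i))
  rw [← hclosed.closure_eq]
  apply isCompact_closure_of_isTightMeasureSet
  refine (isTightMeasureSet_coupling N ρ).subset ?_
  rintro _ ⟨γ, hγ, rfl⟩
  exact hγ

/-- The law of `(x, …, x)` with `x` distributed according to `ρ` is a coupling. -/
lemma map_diagonal_mem_coupling {X : Type*} [MeasurableSpace X] (N : ℕ) (ρ : Measure X)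
    [IsProbabilityMeasure ρ] : ρ.map (fun x (_ : Fin N) ↦ x) ∈ Coupling N ρ := by
  have hm : Measurable fun (x : X) (_ : Fin N) ↦ x := measurable_pi_lambda _ fun _ ↦ measurable_id
  refine ⟨Measure.isProbabilityMeasure_map hm.aemeasurable, fun i ↦ ?_⟩
  rw [Measure.map_map (measurable_pi_apply i) hm]
  exact Measure.map_id

lemma lintegral_apply_of_mem_coupling {X : Type*} [MeasurableSpace X] {N : ℕ} {ρ : Measure X}
    {γ : Measure (Fin N → X)} (hγ : γ ∈ Coupling N ρ) {h : X → ℝ≥0∞} (hh : Measurable h)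
    (i : Fin N) : ∫⁻ x, h (x i) ∂γ = ∫⁻ x, h x ∂ρ := by
  rw [← hγ.2 i, lintegral_map hh (measurable_pi_apply i)]

lemma erealPosPart_coe (r : ℝ) : erealPosPart (r : EReal) = ENNReal.ofReal r := by
  simp [erealPosPart]

/-- If `a + h = g` with `h` finite and `g` nonnegative, then `a⁺ + h = a⁻ + g`. -/
lemma erealPosPart_add_eq {a : EReal} {h g : ℝ≥0∞} (hh : h ≠ ⊤) (hag : a + h = g) :
    erealPosPart a + h = erealPosPart (-a) + g := by
  lift h to ℝ≥0 using hh
  induction a with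
  | bot =>
    rw [EReal.bot_add] at hag
    exact absurd hag.symm (EReal.coe_ennreal_ne_bot g)
  | top =>
    have : g = ⊤ := by
      rw [← EReal.coe_ennreal_eq_top_iff, ← hag]
      exact EReal.top_add_coe _
    simp [erealPosPart, this]
  | coe r =>
    have hg : g ≠ ⊤ := by
      rintro rfl
      exact EReal.coe_ne_top (r + h) hag
    lift g to ℝ≥0 using hg
    have hr : r + h = g := EReal.coe_injective hag
    rw [← EReal.coe_neg, erealPosPart_coe, erealPosPart_coe]
    have e1 : (h : ℝ≥0∞) = ENNReal.ofReal (h : ℝ) := by simp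
    have e2 : (g : ℝ≥0∞) = ENNReal.ofReal (g : ℝ) := by simp
    rcases le_total 0 r with h0 | h0
    · rw [ENNReal.ofReal_of_nonpos (by linarith : -r ≤ 0), e1, e2,
        ← ENNReal.ofReal_add h0 h.coe_nonneg, hr, zero_add]
    · rw [ENNReal.ofReal_of_nonpos h0, e1, e2,
        ← ENNReal.ofReal_add (neg_nonneg.2 h0) g.coe_nonneg, ← hr, zero_add, neg_add_cancel_left]

lemma erealPosPart_neg_le {a : EReal} {h g : ℝ≥0∞} (hag : a + h = g) :
    erealPosPart (-a) ≤ h := by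
  rcases eq_or_ne h ⊤ with rfl | hh
  · exact le_top
  lift h to ℝ≥0 using hh
  induction a with
  | bot =>
    rw [EReal.bot_add] at hag
    exact absurd hag.symm (EReal.coe_ennreal_ne_bot g)
  | top => simp [erealPosPart]
  | coe r =>
    have h0 : (0 : EReal) ≤ ((r + h : ℝ) : EReal) := by
      have : ((r + h : ℝ) : EReal) = g := by rw [← hag]; rfl
      rw [this]; exact EReal.coe_ennreal_nonneg g
    rw [← EReal.coe_neg, erealPosPart_coe]
    have : 0 ≤ r + h := by exact_mod_cast h0
    refine (ENNReal.ofReal_le_ofReal (by linarith : -r ≤ h)).trans_eq (by simp)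

/-- A cost which becomes nonnegative and lower semicontinuous after adding a finite function with
constant integral over a compact set of measures has a minimizer there. -/
lemma exists_erealIntegral_le {Y : Type*} [TopologicalSpace Y]
    [TopologicalSpace.PseudoMetrizableSpace Y] [TopologicalSpace.SeparableSpace Y]
    [MeasurableSpace Y] [BorelSpace Y] {S : Set (ProbabilityMeasure Y)} (hS : IsCompact S)
    (hne : S.Nonempty) {c : Y → EReal} {H G : Y → ℝ≥0∞} (hH : Measurable H)
    (hHtop : ∀ y, H y ≠ ⊤) (hG : LowerSemicontinuous G) (hcHG : ∀ y, c y + H y = G y)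
    {M : ℝ≥0∞} (hM : M ≠ ⊤) (hHM : ∀ γ ∈ S, ∫⁻ y, H y ∂(γ : Measure Y) = M) :
    ∃ γ ∈ S, ∀ γ' ∈ S,
      erealIntegral (γ : Measure Y) c ≤ erealIntegral (γ' : Measure Y) c := by
  obtain ⟨γ, hγ, hmin⟩ := LowerSemicontinuousOn.exists_isMinOn hne hS
    ((lowerSemicontinuous_lintegral_probabilityMeasure hG).lowerSemicontinuousOn S)
  have key : ∀ γ ∈ S, erealIntegral (γ : Measure Y) c =
      ((∫⁻ y, G y ∂(γ : Measure Y) : ℝ≥0∞) : EReal) - (M : EReal) := by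
    intro γ hγ
    have hQ : ∫⁻ y, erealPosPart (-(c y)) ∂(γ : Measure Y) ≠ ⊤ := by
      refine ne_top_of_le_ne_top hM ?_
      rw [← hHM γ hγ]
      exact lintegral_mono fun y ↦ erealPosPart_neg_le (hcHG y)
    have hsum : (∫⁻ y, erealPosPart (c y) ∂(γ : Measure Y)) + M =
        (∫⁻ y, erealPosPart (-(c y)) ∂(γ : Measure Y)) + ∫⁻ y, G y ∂(γ : Measure Y) := by
      rw [← hHM γ hγ, ← lintegral_add_right _ hH, ← lintegral_add_right _ hG.measurable]
      exact lintegral_congr fun y ↦ erealPosPart_add_eq (hHtop y) (hcHG y)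
    unfold erealIntegral
    generalize (∫⁻ y, erealPosPart (c y) ∂(γ : Measure Y)) = P at *
    generalize (∫⁻ y, erealPosPart (-(c y)) ∂(γ : Measure Y)) = Q at *
    generalize (∫⁻ y, G y ∂(γ : Measure Y)) = I at *
    lift M to ℝ≥0 using hM
    lift Q to ℝ≥0 using hQ
    by_cases hP : P = ⊤
    · have hI : I = ⊤ := by simpa [hP] using hsum.symm
      rw [hP, hI]
      exact (EReal.top_sub_coe _).trans (EReal.top_sub_coe _).symm
    · have hI : I ≠ ⊤ := by
        rintro rfl
        simp [hP] at hsum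
      lift P to ℝ≥0 using hP
      lift I to ℝ≥0 using hI
      have h : (P : ℝ) + M = Q + I := by exact_mod_cast hsum
      have h' : (P : ℝ) - Q = I - M := by linarith
      exact congrArg (fun r : ℝ ↦ (r : EReal)) h'
  refine ⟨γ, hγ, fun γ' hγ' ↦ ?_⟩
  rw [key γ hγ, key γ' hγ']
  exact EReal.sub_le_sub (EReal.coe_ennreal_le_coe_ennreal_iff.2 (hmin hγ')) le_rfl

/-- If `f 0 = ⊥`, the diagonal coupling has cost `⊥`. -/
lemma erealIntegral_map_diagonal_eq_bot {X : Type*} [MetricSpace X] [SecondCountableTopology X]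
    [MeasurableSpace X] [BorelSpace X] {N : ℕ} (hN : 2 ≤ N) {f : ℝ → EReal} (hf : f 0 = ⊥)
    (ρ : Measure X) [IsProbabilityMeasure ρ] :
    erealIntegral (ρ.map (fun x (_ : Fin N) ↦ x)) (pairCost N f) = ⊥ := by
  have hm : Measurable fun (x : X) (_ : Fin N) ↦ x := measurable_pi_lambda _ fun _ ↦ measurable_id
  let i : Fin N := ⟨0, by lia⟩
  let j : Fin N := ⟨1, by lia⟩
  have hij : i < j := Fin.mk_lt_mk.2 zero_lt_one
  let D : Set (Fin N → X) := {x | x i = x j}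
  have hD : MeasurableSet D := measurableSet_eq_fun (measurable_pi_apply i) (measurable_pi_apply j)
  have hc : ∀ x ∈ D, pairCost N f x = ⊥ := by
    intro x hx
    have hx' : x i = x j := hx
    unfold pairCost
    rw [← Finset.add_sum_erase _ _ (a := (i, j)) (by simpa using hij)]
    simp [hf, hx']
  have htop : ∫⁻ x, erealPosPart (-(pairCost N f x)) ∂(ρ.map (fun x (_ : Fin N) ↦ x)) = ⊤ := by
    refine top_unique (le_trans ?_ (setLIntegral_le_lintegral D _))
    rw [setLIntegral_congr_fun hD (g := fun _ ↦ ⊤) fun x hx ↦ by simp [hc x hx, erealPosPart],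
      setLIntegral_const, Measure.map_apply hm hD]
    simp [D]
  rw [erealIntegral, htop]
  simp

/-- If `f` is continuous on `(0, ∞)` and tends to `⊤` at `0⁺`, then its restriction to `[0, ∞)`,
extended by `f 0` to the left, is lower semicontinuous. -/
lemma lowerSemicontinuous_of_tendsto_top {f : ℝ → EReal} (hf_cont : ContinuousOn f (Ioi 0))
    (hf_tend : Tendsto f (𝓝[>] (0 : ℝ)) (𝓝 (⊤ : EReal))) :
    LowerSemicontinuous fun t ↦ f (max t 0) := by
  intro t y hy
  rcases lt_trichotomy t 0 with ht | rfl | ht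
  · filter_upwards [Iio_mem_nhds ht] with s hs
    rwa [max_eq_right (le_of_lt hs), ← max_eq_right ht.le]
  · simp only [max_self] at hy
    have h1 : ∀ᶠ s in 𝓝[>] (0 : ℝ), y < f s :=
      hf_tend.eventually (lt_mem_nhds (hy.trans_le le_top))
    rw [eventually_nhdsWithin_iff] at h1
    filter_upwards [h1] with s hs
    rcases le_or_gt s 0 with h | h
    · rwa [max_eq_right h]
    · rw [max_eq_left h.le]
      exact hs h
  · have h1 : ContinuousAt f t := hf_cont.continuousAt (Ioi_mem_nhds ht)
    simp only [max_eq_left ht.le] at hy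
    filter_upwards [h1.eventually (lt_mem_nhds hy), Ioi_mem_nhds ht] with s hs hs0
    rwa [max_eq_left (le_of_lt hs0)]

/-- Identities `aᵢ + hᵢ = gᵢ` in `EReal` with `hᵢ`, `gᵢ` nonnegative may be summed. -/
lemma sum_ereal_add_eq {ι : Type*} (s : Finset ι) {a : ι → EReal} {h g : ι → ℝ≥0∞}
    (hag : ∀ i ∈ s, a i + h i = g i) :
    (∑ i ∈ s, a i) + ((∑ i ∈ s, h i : ℝ≥0∞) : EReal) = ((∑ i ∈ s, g i : ℝ≥0∞) : EReal) := by
  classical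
  induction s using Finset.induction_on with
  | empty => simp
  | insert i s hi ih =>
    rw [Finset.sum_insert hi, Finset.sum_insert hi, Finset.sum_insert hi, EReal.coe_ennreal_add,
      EReal.coe_ennreal_add, ← hag i (by simp), ← ih fun j hj ↦ hag j (by simp [hj]),
      add_add_add_comm]


theorem stmt0 {X : Type*} [MetricSpace X] [CompleteSpace X] [TopologicalSpace.SeparableSpace X]
    [MeasurableSpace X] [BorelSpace X]
    (N : ℕ) (hN : 2 ≤ N) (f : ℝ → EReal)
    (hf_real : ∀ t : ℝ, 0 < t → f t ≠ ⊤ ∧ f t ≠ ⊥)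
    (hf_cont : ContinuousOn f (Ioi 0))
    (hf_anti : AntitoneOn f (Ioi 0))
    (hf_tend : Tendsto f (𝓝[>] (0 : ℝ)) (𝓝 (⊤ : EReal)))
    (ρ : Measure X) [IsProbabilityMeasure ρ]
    (hA : ∃ r > (0 : ℝ), (⨆ x : X, ρ (ball x r)) < ((N * (N - 1) ^ 2 : ℕ) : ℝ≥0∞)⁻¹)
    (hB : ∃ o : X, ∃ r₀ > (0 : ℝ),
      ∫⁻ x in (ball o r₀)ᶜ, erealPosPart (-(f (2 * dist x o))) ∂ρ < ⊤) :
    ∃ γ ∈ Coupling N ρ, ∀ γ' ∈ Coupling N ρ,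
      erealIntegral γ (pairCost N f) ≤ erealIntegral γ' (pairCost N f) := by
  have := UniformSpace.secondCountable_of_separable X
  have hdiag := map_diagonal_mem_coupling N ρ
  by_cases hbot : f 0 = ⊥
  · refine ⟨_, hdiag, fun γ' _ ↦ ?_⟩
    rw [erealIntegral_map_diagonal_eq_bot hN hbot ρ]
    exact bot_le
  obtain ⟨o, r₀, hr₀, hint⟩ := hB
  let k : ℝ≥0 := (-(f 0).toReal).toNNReal
  let h : X → ℝ≥0 := fun x ↦ (-(f (2 * max (dist x o) r₀)).toReal).toNNReal + k
  have hpos : ∀ x : X, 0 < 2 * max (dist x o) r₀ := fun x ↦ by positivity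
  have hcont : Continuous h := by
    refine (continuous_real_toNNReal.comp ?_).add continuous_const
    refine Continuous.neg ?_
    rw [continuous_iff_continuousAt]
    intro x
    have h1 : ContinuousAt f (2 * max (dist x o) r₀) :=
      hf_cont.continuousAt (Ioi_mem_nhds (hpos x))
    have h2 : Continuous fun x : X ↦ 2 * max (dist x o) r₀ := by fun_prop
    have h3 : ContinuousAt EReal.toReal (f (2 * max (dist x o) r₀)) :=
      EReal.tendsto_toReal (hf_real _ (hpos x)).1 (hf_real _ (hpos x)).2
    exact ContinuousAt.comp (f := fun x ↦ f (2 * max (dist x o) r₀)) h3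
      (ContinuousAt.comp (f := fun x : X ↦ 2 * max (dist x o) r₀) h1 h2.continuousAt)
  have hfin : ∫⁻ x, h x ∂ρ ≠ ⊤ := by
    rw [← lintegral_add_compl _ (measurableSet_ball (x := o) (ε := r₀))]
    refine ENNReal.add_ne_top.2 ⟨?_, ?_⟩
    · refine ne_top_of_le_ne_top (b := ∫⁻ _ in ball o r₀,
        (((-(f (2 * r₀)).toReal).toNNReal + k : ℝ≥0) : ℝ≥0∞) ∂ρ) ?_ ?_
      · rw [lintegral_const]
        exact ENNReal.mul_ne_top ENNReal.coe_ne_top (measure_ne_top _ _)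
      · refine setLIntegral_mono measurable_const fun x hx ↦ ?_
        rw [mem_ball] at hx
        simp only [h, max_eq_right hx.le, le_refl]
    · have hle : ∫⁻ x in (ball o r₀)ᶜ, h x ∂ρ ≤
          ∫⁻ x in (ball o r₀)ᶜ, (erealPosPart (-(f (2 * dist x o))) + k) ∂ρ := by
        refine setLIntegral_mono' measurableSet_ball.compl fun x hx ↦ ?_
        have hx' : r₀ ≤ dist x o := by simpa using hx
        have hp : 0 < 2 * dist x o := by linarith
        lift f (2 * dist x o) to ℝ using hf_real _ hp with v hv
        simp only [h, max_eq_left hx', ← hv]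
        rw [← EReal.coe_neg, erealPosPart_coe, EReal.toReal_coe, ENNReal.coe_add]
        exact le_rfl
      refine ne_top_of_le_ne_top ?_ hle
      rw [lintegral_add_right _ measurable_const, lintegral_const]
      exact ENNReal.add_ne_top.2 ⟨hint.ne, ENNReal.mul_ne_top ENNReal.coe_ne_top
        (measure_ne_top _ _)⟩
  have hlow : ∀ x y : X, 0 ≤ f (dist x y) + ((h x + h y : ℝ≥0) : ℝ) := by
    intro x y
    have hcoe : ∀ v : ℝ, 0 ≤ v + ((h x + h y : ℝ≥0) : ℝ) →
        0 ≤ (v : EReal) + (((h x + h y : ℝ≥0) : ℝ) : EReal) := fun v hv ↦ by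
      exact_mod_cast hv
    have hk : ((k : ℝ≥0) : ℝ) ≤ ((h x + h y : ℝ≥0) : ℝ) := by
      refine NNReal.coe_le_coe.2 (le_trans ?_ le_self_add)
      exact le_add_self
    rcases eq_or_lt_of_le (dist_nonneg (x := x) (y := y)) with h0 | h0
    · rw [← h0]
      rcases eq_or_ne (f 0) ⊤ with htop | htop
      · rw [htop, EReal.top_add_coe]
        exact le_top
      · rw [← EReal.coe_toReal htop hbot]
        refine hcoe _ ?_
        have := Real.le_coe_toNNReal (-(f 0).toReal)
        linarith
    · have hz : ∃ z, (z = x ∨ z = y) ∧ dist x y ≤ 2 * max (dist z o) r₀ := by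
        have htri := dist_triangle_right x y o
        rcases le_total (dist x o) (dist y o) with hxy | hxy
        · exact ⟨y, Or.inr rfl, by linarith [le_max_left (dist y o) r₀]⟩
        · exact ⟨x, Or.inl rfl, by linarith [le_max_left (dist x o) r₀]⟩
      obtain ⟨z, hz, hd⟩ := hz
      have hfz := hf_anti (mem_Ioi.2 h0) (mem_Ioi.2 (hpos z)) hd
      have hzh : h z ≤ h x + h y := by
        rcases hz with rfl | rfl
        · exact le_self_add
        · exact le_add_self
      have hzr := hf_real _ (hpos z)
      have h1 : -(f (2 * max (dist z o) r₀)).toReal ≤ ((h x + h y : ℝ≥0) : ℝ) :=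
        (Real.le_coe_toNNReal _).trans
          (NNReal.coe_le_coe.2 ((le_self_add (a := Real.toNNReal _) (b := k)).trans hzh))
      have h2 := EReal.toReal_le_toReal hfz hzr.2 (hf_real _ h0).1
      rw [← EReal.coe_toReal (hf_real _ h0).1 (hf_real _ h0).2]
      exact hcoe _ (by linarith)
  let s : Finset (Fin N × Fin N) := Finset.univ.filter fun p ↦ p.1 < p.2
  let H : (Fin N → X) → ℝ≥0∞ := fun x ↦ ∑ p ∈ s, ((h (x p.1) + h (x p.2) : ℝ≥0) : ℝ≥0∞)
  let G : (Fin N → X) → ℝ≥0∞ := fun x ↦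
    ∑ p ∈ s, (f (dist (x p.1) (x p.2)) + ((h (x p.1) + h (x p.2) : ℝ≥0) : ℝ)).toENNReal
  have hHmeas : Measurable H := by
    have := hcont.measurable
    fun_prop
  have hG : LowerSemicontinuous G := by
    refine lowerSemicontinuous_sum fun p _ ↦ ?_
    refine EReal.continuous_toENNReal.comp_lowerSemicontinuous ?_
      (fun a b hab ↦ EReal.toENNReal_le_toENNReal hab)
    refine LowerSemicontinuous.add' ?_ (Continuous.lowerSemicontinuous ?_) fun x ↦ ?_
    · have h1 := LowerSemicontinuous.comp (lowerSemicontinuous_of_tendsto_top hf_cont hf_tend)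
        (g := fun x : Fin N → X ↦ dist (x p.1) (x p.2)) (by fun_prop)
      simpa only [Function.comp_def, max_eq_left dist_nonneg] using h1
    · exact continuous_coe_real_ereal.comp (by fun_prop)
    · exact EReal.continuousAt_add (Or.inr (EReal.coe_ne_bot _)) (Or.inr (EReal.coe_ne_top _))
  obtain ⟨γ, hγ, hmin⟩ := exists_erealIntegral_le (isCompact_coupling N ρ)
    ⟨⟨_, hdiag.1⟩, hdiag⟩ (c := pairCost N f) hHmeas
    (fun x ↦ ENNReal.sum_ne_top.2 fun p _ ↦ ENNReal.coe_ne_top) hG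
    (fun x ↦ sum_ereal_add_eq s fun p _ ↦ (EReal.coe_toENNReal (hlow _ _)).symm)
    (M := ∑ _p ∈ s, ((∫⁻ x, h x ∂ρ) + ∫⁻ x, h x ∂ρ))
    (ENNReal.sum_ne_top.2 fun p _ ↦ ENNReal.add_ne_top.2 ⟨hfin, hfin⟩) (by
      intro γ hγ
      have hm : Measurable fun x ↦ (h x : ℝ≥0∞) := hcont.measurable.coe_nnreal_ennreal
      have hmi : ∀ i : Fin N, Measurable fun x : Fin N → X ↦ (h (x i) : ℝ≥0∞) :=
        fun i ↦ hm.comp (measurable_pi_apply i)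
      simp only [H, ENNReal.coe_add]
      rw [lintegral_finsetSum _ fun p _ ↦ (hmi p.1).add (hmi p.2)]
      refine Finset.sum_congr rfl fun p _ ↦ ?_
      rw [lintegral_add_right _ (hmi p.2), lintegral_apply_of_mem_coupling hγ hm,
        lintegral_apply_of_mem_coupling hγ hm])
  exact ⟨γ, hγ, fun γ' hγ' ↦ hmin ⟨γ', hγ'.1⟩ hγ'⟩
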